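/- arXiv:2212.01943 — 2 statements merged into one kernel-verified Lean document; each statement's English description precedes it below -/
import Mathlib

section
/- Let Y ~ Pois(μ) with independent copy Ỹ, and let g : ℤ_+^n → ℝ^n have strictly positive coordinate functions, with E|Y_i log Y_i| < ∞, E|Y_i log g_i(Y−e_i)| < ∞, and E|g_i(Y)| < ∞ for each i (using the convention 0·log 0 = 0). Then E[ 2 Σ_{i=1}^n ( Y_i log Y_i − Y_i log g_i(Y−e_i) + g_i(Y) − Y_i ) ] = 2 E[ Σ_{i=1}^n ( Ỹ_i log(Ỹ_i / g_i(Y)) + g_i(Y) − Ỹ_i ) ], i.e., UE^dev is an unbiased estimator of the Poisson-deviance test error Err^dev(g). -/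
open MeasureTheory ProbabilityTheory Filter Set

noncomputable section

/-- Euclidean inner product on `ℝ^n`. -/
def dotR {n : ℕ} (u v : Fin n → ℝ) : ℝ := ∑ i, u i * v i

/-- Bregman divergence `D_φ(a,b) = φ(a) - φ(b) - ⟨∇φ(b), a - b⟩`, with gradient `φ'`. -/
def breg {n : ℕ} (φ : (Fin n → ℝ) → ℝ) (φ' : (Fin n → ℝ) → Fin n → ℝ)
    (a b : Fin n → ℝ) : ℝ :=
  φ a - φ b - dotR (φ' b) (fun i => a i - b i)

/-- Coercion of a nonnegative-integer vector to a real vector. -/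
def toR {n : ℕ} (y : Fin n → ℕ) : Fin n → ℝ := fun i => (y i : ℝ)

/-- `φ` is differentiable everywhere with gradient `φ'`. -/
def HasGrad {n : ℕ} (φ : (Fin n → ℝ) → ℝ) (φ' : (Fin n → ℝ) → Fin n → ℝ) : Prop :=
  ∀ x, HasFDerivAt φ (∑ i, φ' x i • (ContinuousLinearMap.proj i : (Fin n → ℝ) →L[ℝ] ℝ)) x

/-- Joint pmf of `n` independent Poisson coordinates with mean vector `ν`. -/
def poisPMF {n : ℕ} (ν : Fin n → ℝ) (y : Fin n → ℕ) : ℝ :=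
  ∏ i, Real.exp (-ν i) * ν i ^ y i / Nat.factorial (y i)

/-- `Y ~ Pois(ν)`: the coordinates of `Y` are independent Poissons with means `ν i`. -/
def HasPoissonLaw {Ω : Type*} [MeasurableSpace Ω] {n : ℕ} (P : Measure Ω)
    (ν : Fin n → ℝ) (Y : Ω → Fin n → ℕ) : Prop :=
  ∀ y, P {ω | Y ω = y} = ENNReal.ofReal (poisPMF ν y)

/-- Independence of two discrete random vectors, via factorization of the joint pmf. -/
def IndepDiscrete {Ω : Type*} [MeasurableSpace Ω] {n : ℕ} (P : Measure Ω)
    (Y Z : Ω → Fin n → ℕ) : Prop :=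
  ∀ y z, P {ω | Y ω = y ∧ Z ω = z} = P {ω | Y ω = y} * P {ω | Z ω = z}

/-- Binomial(m, p) pmf at `k`. -/
def binomPMF (m k : ℕ) (p : ℝ) : ℝ := (m.choose k : ℝ) * p ^ k * (1 - p) ^ (m - k)

/-- Joint pmf of independent binomials `ω_i ~ Binom(y_i, p)`. -/
def binomJointPMF {n : ℕ} (y : Fin n → ℕ) (p : ℝ) (w : Fin n → ℕ) : ℝ :=
  ∏ i, binomPMF (y i) (w i) p


theorem HasPoissonLaw.map_singleton {Ω : Type*} [MeasurableSpace Ω] {n : ℕ} {P : Measure Ω}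
    {μ : Fin n → ℝ} {Y : Ω → Fin n → ℕ} (hYm : Measurable Y) (hY : HasPoissonLaw P μ Y)
    (y : Fin n → ℕ) : P.map Y {y} = ENNReal.ofReal (poisPMF μ y) := by
  rw [Measure.map_apply hYm (measurableSet_singleton y)]
  exact hY y

theorem IndepDiscrete.indepFun {Ω : Type*} [MeasurableSpace Ω] {n : ℕ} {P : Measure Ω}
    [IsProbabilityMeasure P] {Y Z : Ω → Fin n → ℕ} (hYm : Measurable Y) (hZm : Measurable Z)
    (h : IndepDiscrete P Y Z) : IndepFun Y Z P := by
  have := Measure.isProbabilityMeasure_map (μ := P) hYm.aemeasurable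
  have := Measure.isProbabilityMeasure_map (μ := P) hZm.aemeasurable
  rw [indepFun_iff_map_prod_eq_prod_map_map hYm.aemeasurable hZm.aemeasurable]
  refine Measure.ext_of_singleton fun ⟨y, z⟩ => ?_
  rw [Measure.map_apply (hYm.prodMk hZm) (measurableSet_singleton _), ← Set.singleton_prod_singleton,
    Measure.prod_prod, Measure.map_apply hYm (measurableSet_singleton _),
    Measure.map_apply hZm (measurableSet_singleton _)]
  exact h y z

theorem poisPMF_add_single {n : ℕ} (μ : Fin n → ℝ) (z : Fin n → ℕ) (i : Fin n) :
    ((z i : ℝ) + 1) * poisPMF μ (z + Pi.single i 1) = μ i * poisPMF μ z := by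
  have hne : ∏ j ∈ Finset.univ.erase i, Real.exp (-μ j) * μ j ^ (z + Pi.single i 1 : Fin n → ℕ) j /
        Nat.factorial ((z + Pi.single i 1 : Fin n → ℕ) j)
      = ∏ j ∈ Finset.univ.erase i, Real.exp (-μ j) * μ j ^ z j / Nat.factorial (z j) :=
    Finset.prod_congr rfl fun j hj => by simp [Finset.ne_of_mem_erase hj]
  rw [poisPMF, poisPMF, ← Finset.mul_prod_erase _ _ (Finset.mem_univ i),
    ← Finset.mul_prod_erase Finset.univ (fun j => Real.exp (-μ j) * μ j ^ z j / _)
      (Finset.mem_univ i), hne, ← mul_assoc, ← mul_assoc]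
  congr 1
  have h : (Nat.factorial (z i) : ℝ) ≠ 0 := by positivity
  have h' : (z i : ℝ) + 1 ≠ 0 := by positivity
  simp only [Pi.add_apply, Pi.single_eq_same, Nat.factorial_succ, pow_succ]
  push_cast
  field_simp

/-- Size-biasing a Poisson law in coordinate `i` shifts it by the unit vector `e_i`. -/
theorem withDensity_coord_eq_map_add_single {n : ℕ} {μ : Fin n → ℝ} (hμ : ∀ i, 0 ≤ μ i)
    {ν : Measure (Fin n → ℕ)} (hν : ∀ y, ν {y} = ENNReal.ofReal (poisPMF μ y)) (i : Fin n) :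
    ν.withDensity (fun y => ((y i : NNReal) : ENNReal))
      = ((μ i).toNNReal • ν).map (· + Pi.single i 1) := by
  refine Measure.ext_of_singleton fun y => ?_
  rw [withDensity_apply _ (measurableSet_singleton y), lintegral_singleton,
    Measure.map_apply (measurable_of_countable _) (measurableSet_singleton y)]
  rcases Nat.eq_zero_or_pos (y i) with h0 | hpos
  · have : (· + Pi.single i 1) ⁻¹' {y} = (∅ : Set (Fin n → ℕ)) := by
      ext z
      simp only [Set.mem_preimage, Set.mem_singleton_iff, Set.mem_empty_iff_false, iff_false]
      rintro rfl
      simp at h0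
    simp [this, h0]
  · obtain ⟨z, rfl⟩ : ∃ z, y = z + Pi.single i 1 := by
      refine ⟨y - Pi.single i 1, (tsub_add_cancel_of_le fun j => ?_).symm⟩
      rcases eq_or_ne j i with rfl | hj
      · simpa using Nat.succ_le_of_lt hpos
      · simp [hj]
    have : (· + Pi.single i 1) ⁻¹' {z + Pi.single i 1} = ({z} : Set (Fin n → ℕ)) := by
      ext w
      simp
    rw [this, Measure.smul_apply, hν, hν, ENNReal.smul_def, smul_eq_mul,
      ENNReal.ofNNReal_toNNReal, ← ENNReal.ofReal_mul (hμ i), ← poisPMF_add_single,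
      ENNReal.ofReal_mul (by positivity)]
    simp [ENNReal.ofReal_add]

theorem integrable_coord_mul_iff {n : ℕ} {μ : Fin n → ℝ} (hμ : ∀ i, 0 ≤ μ i)
    {ν : Measure (Fin n → ℕ)} (hν : ∀ y, ν {y} = ENNReal.ofReal (poisPMF μ y)) {i : Fin n}
    (hi : μ i ≠ 0) (h : (Fin n → ℕ) → ℝ) :
    Integrable (fun y => (y i : ℝ) * h (y - Pi.single i 1)) ν ↔ Integrable h ν := by
  have hm : Measurable fun y : Fin n → ℕ => (y i : NNReal) := measurable_of_countable _
  have := integrable_withDensity_iff_integrable_smul (μ := ν) hm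
    (g := fun y => h (y - Pi.single i 1))
  rw [withDensity_coord_eq_map_add_single hμ hν, integrable_map_measure
    (measurable_of_countable _).aestronglyMeasurable (measurable_of_countable _).aemeasurable] at this
  simp only [NNReal.smul_def, NNReal.coe_natCast, smul_eq_mul] at this
  rw [← this]
  have hc : (fun y => h (y - Pi.single i 1)) ∘ (fun y => y + Pi.single i 1) = h := by
    ext y; simp
  rw [hc]
  refine integrable_smul_measure (c := ((μ i).toNNReal : ENNReal)) ?_ ENNReal.coe_ne_top
  simpa using (hμ i).lt_of_ne' hi

/-- The Poisson summation-by-parts identity `E[Y_i h(Y - e_i)] = μ_i E[h(Y)]`. -/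
theorem integral_coord_mul {n : ℕ} {μ : Fin n → ℝ} (hμ : ∀ i, 0 ≤ μ i)
    {ν : Measure (Fin n → ℕ)} (hν : ∀ y, ν {y} = ENNReal.ofReal (poisPMF μ y)) (i : Fin n)
    (h : (Fin n → ℕ) → ℝ) :
    ∫ y, (y i : ℝ) * h (y - Pi.single i 1) ∂ν = μ i * ∫ y, h y ∂ν := by
  have hm : Measurable fun y : Fin n → ℕ => (y i : NNReal) := measurable_of_countable _
  have := integral_withDensity_eq_integral_smul (μ := ν) hm fun y => h (y - Pi.single i 1)
  rw [withDensity_coord_eq_map_add_single hμ hν, integral_map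
    (measurable_of_countable _).aemeasurable (measurable_of_countable _).aestronglyMeasurable] at this
  simpa [NNReal.smul_def, integral_smul_nnreal_measure, hμ i] using this.symm

/-- The cross term of the deviance is unbiased: `E[Y_i f(Y - e_i)] = E[Ỹ_i f(Y)]`. -/
theorem integrable_and_integral_copy_mul {n : ℕ} {Ω : Type*} [MeasurableSpace Ω] {P : Measure Ω}
    [IsProbabilityMeasure P] {μ : Fin n → ℝ} (hμ : ∀ i, 0 ≤ μ i) {Y Yt : Ω → Fin n → ℕ}
    (hYm : Measurable Y) (hYtm : Measurable Yt) (hY : HasPoissonLaw P μ Y)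
    (hYt : HasPoissonLaw P μ Yt) (hind : IndepDiscrete P Y Yt) {i : Fin n}
    (hint : Integrable (fun ω => (Yt ω i : ℝ)) P) (f : (Fin n → ℕ) → ℝ)
    (hf : Integrable (fun ω => (Y ω i : ℝ) * f (Y ω - Pi.single i 1)) P) :
    Integrable (fun ω => (Yt ω i : ℝ) * f (Y ω)) P ∧
      ∫ ω, (Yt ω i : ℝ) * f (Y ω) ∂P = ∫ ω, (Y ω i : ℝ) * f (Y ω - Pi.single i 1) ∂P := by
  have hmf : Measurable f := measurable_of_countable f
  have hmc : Measurable fun y : Fin n → ℕ => (y i : ℝ) := measurable_of_countable _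
  have hms : Measurable fun y : Fin n → ℕ => (y i : ℝ) * f (y - Pi.single i 1) :=
    measurable_of_countable _
  have hindep : IndepFun (fun ω => (Yt ω i : ℝ)) (fun ω => f (Y ω)) P :=
    (hind.indepFun hYm hYtm).symm.comp hmc hmf
  have hmean : ∫ ω, (Yt ω i : ℝ) ∂P = μ i := by
    have := Measure.isProbabilityMeasure_map (μ := P) hYtm.aemeasurable
    rw [← integral_map hYtm.aemeasurable hmc.aestronglyMeasurable]
    simpa using integral_coord_mul hμ (hYt.map_singleton hYtm) i fun _ => 1
  refine ⟨?_, ?_⟩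
  · by_cases hi : μ i = 0
    · rw [hi, integral_eq_zero_iff_of_nonneg (fun ω => Nat.cast_nonneg _) hint] at hmean
      refine (integrable_zero Ω ℝ P).congr ?_
      filter_upwards [hmean] with ω hω
      simp only [Pi.zero_apply] at hω
      simp [hω]
    · refine hindep.integrable_mul hint ?_
      refine (integrable_map_measure hmf.aestronglyMeasurable hYm.aemeasurable).1 ?_
      exact (integrable_coord_mul_iff hμ (hY.map_singleton hYm) hi f).1
        ((integrable_map_measure hms.aestronglyMeasurable hYm.aemeasurable).2 hf)
  · rw [hindep.integral_fun_mul_eq_mul_integral hint.aestronglyMeasurable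
      (hmf.comp hYm).aestronglyMeasurable, hmean,
      ← integral_map hYm.aemeasurable hmf.aestronglyMeasurable,
      ← integral_coord_mul hμ (hY.map_singleton hYm) i f,
      integral_map hYm.aemeasurable hms.aestronglyMeasurable]

theorem natCast_le_three_add_mul_log (k : ℕ) : (k : ℝ) ≤ 3 + k * Real.log k := by
  have hlog : 0 ≤ (k : ℝ) * Real.log k := mul_nonneg k.cast_nonneg (Real.log_natCast_nonneg k)
  rcases lt_or_ge k 3 with hk | hk
  · have : (k : ℝ) < 3 := by exact_mod_cast hk
    linarith
  · have hk' : (3 : ℝ) ≤ k := by exact_mod_cast hk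
    have : 1 ≤ Real.log k := by
      rw [Real.le_log_iff_exp_le (by linarith)]
      linarith [Real.exp_one_lt_d9]
    nlinarith

theorem integral_sum_sub_add_sub {α ι : Type*} [MeasurableSpace α] [Fintype ι] {ν : Measure α}
    {a b c d : ι → α → ℝ} (ha : ∀ i, Integrable (a i) ν) (hb : ∀ i, Integrable (b i) ν)
    (hc : ∀ i, Integrable (c i) ν) (hd : ∀ i, Integrable (d i) ν) :
    ∫ x, ∑ i, (a i x - b i x + c i x - d i x) ∂ν
      = ∑ i, (∫ x, a i x ∂ν - ∫ x, b i x ∂ν + ∫ x, c i x ∂ν - ∫ x, d i x ∂ν) := by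
  have hab (i) : Integrable (fun x => a i x - b i x) ν := (ha i).sub (hb i)
  have habc (i) : Integrable (fun x => a i x - b i x + c i x) ν := (hab i).add (hc i)
  rw [integral_finsetSum _ fun i _ => (habc i).sub' (hd i)]
  refine Finset.sum_congr rfl fun i _ => ?_
  rw [integral_sub (habc i) (hd i), integral_add (hab i) (hc i), integral_sub (ha i) (hb i)]

/-- `UE^dev = 2 Σ_i (Y_i log Y_i - Y_i log g_i(Y - e_i) + g_i(Y) - Y_i)` is
unbiased for the Poisson-deviance test error
`Err^dev(g) = 2 E[Σ_i (Ỹ_i log(Ỹ_i / g_i(Y)) + g_i(Y) - Ỹ_i)]`. -/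
theorem stmt6 {n : ℕ} {Ω : Type*} [MeasurableSpace Ω] (P : Measure Ω) [IsProbabilityMeasure P]
    (μ : Fin n → ℝ) (hμ : ∀ i, 0 ≤ μ i)
    (Y Yt : Ω → Fin n → ℕ) (hYm : Measurable Y) (hYtm : Measurable Yt)
    (hY : HasPoissonLaw P μ Y) (hYt : HasPoissonLaw P μ Yt)
    (hind : IndepDiscrete P Y Yt)
    (g : (Fin n → ℕ) → Fin n → ℝ) (hgpos : ∀ y i, 0 < g y i)
    (h1 : ∀ i, Integrable (fun ω => (Y ω i : ℝ) * Real.log (Y ω i : ℝ)) P)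
    (h2 : ∀ i, Integrable (fun ω => (Y ω i : ℝ) * Real.log (g (Y ω - Pi.single i 1) i)) P)
    (h3 : ∀ i, Integrable (fun ω => g (Y ω) i) P) :
    (∫ ω, 2 * ∑ i, ((Y ω i : ℝ) * Real.log (Y ω i : ℝ)
        - (Y ω i : ℝ) * Real.log (g (Y ω - Pi.single i 1) i)
        + g (Y ω) i - (Y ω i : ℝ)) ∂P)
      = 2 * ∫ ω, ∑ i, ((Yt ω i : ℝ) * Real.log ((Yt ω i : ℝ) / g (Y ω) i)
          + g (Y ω) i - (Yt ω i : ℝ)) ∂P := by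
  have hmap : P.map Y = P.map Yt := Measure.ext_of_singleton fun y => by
    rw [hY.map_singleton hYm, hYt.map_singleton hYtm]
  have hid : IdentDistrib Y Yt P P := ⟨hYm.aemeasurable, hYtm.aemeasurable, hmap⟩
  have hidc (i) : IdentDistrib (fun ω => (Y ω i : ℝ)) (fun ω => (Yt ω i : ℝ)) P P :=
    hid.comp (measurable_of_countable fun y : Fin n → ℕ => (y i : ℝ))
  have hidl (i) : IdentDistrib (fun ω => (Y ω i : ℝ) * Real.log (Y ω i : ℝ))
      (fun ω => (Yt ω i : ℝ) * Real.log (Yt ω i : ℝ)) P P :=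
    hid.comp (measurable_of_countable fun y : Fin n → ℕ => (y i : ℝ) * Real.log (y i : ℝ))
  have hYi (i) : Integrable (fun ω => (Y ω i : ℝ)) P :=
    ((integrable_const 3).add (h1 i)).mono' (hidc i).aemeasurable_fst.aestronglyMeasurable
      (.of_forall fun ω => by simpa using natCast_le_three_add_mul_log (Y ω i))
  have hYti (i) : Integrable (fun ω => (Yt ω i : ℝ)) P := (hidc i).integrable_iff.1 (hYi i)
  have h1t (i) := (hidl i).integrable_iff.1 (h1 i)
  have hcross (i) := integrable_and_integral_copy_mul hμ hYm hYtm hY hYt hind (hYti i)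
    (fun y => Real.log (g y i)) (h2 i)
  have hsplit (ω) (i) : (Yt ω i : ℝ) * Real.log ((Yt ω i : ℝ) / g (Y ω) i)
      = (Yt ω i : ℝ) * Real.log (Yt ω i : ℝ) - (Yt ω i : ℝ) * Real.log (g (Y ω) i) := by
    rcases eq_or_ne (Yt ω i : ℝ) 0 with h0 | h0
    · simp [h0]
    · rw [Real.log_div h0 (hgpos _ _).ne', mul_sub]
  simp only [hsplit]
  rw [integral_const_mul, integral_sum_sub_add_sub h1 h2 h3 hYi,
    integral_sum_sub_add_sub h1t (fun i => (hcross i).1) h3 hYti]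
  simp only [(hcross _).2, (hidc _).integral_eq, (hidl _).integral_eq]
end
end

section
/- Let Y ~ Pois(μ), let g : ℤ_+^n → ℝ^n be any function, D_φ any Bregman divergence, 0 < p < 1, and B ≥ 1. Generate ω^b | Y ~ Binom(Y, p) independently for b = 1,…,B, set Y^{*b} = Y − ω^b and Y^{†b} = ((1−p)/p)ω^b, and define the coupled bootstrap estimator CB_p(g) = (1/B) Σ_{b=1}^B [ D_φ(Y^{†b}, g(Y^{*b})) + φ(Y^{*b}) − φ(Y^{†b}) ]. Assuming all terms have finite expectation, E[CB_p(g)] = Err_p(g), where Err_p(g) = E[D_φ(Ỹ_p, g(Y_p))] with Y_p, Ỹ_p ~ Pois((1−p)μ) independent. -/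
open MeasureTheory ProbabilityTheory Filter Set

noncomputable section

/-- Joint law of `Y ~ Pois(ν)` together with `B` conditionally i.i.d. draws
`ω^b | Y ~ Binom(Y, p)`. -/
def JointPoisBinomLawMulti {Ω : Type*} [MeasurableSpace Ω] {n B : ℕ} (P : Measure Ω)
    (ν : Fin n → ℝ) (p : ℝ) (Y : Ω → Fin n → ℕ) (W : Fin B → Ω → Fin n → ℕ) : Prop :=
  ∀ (y : Fin n → ℕ) (w : Fin B → Fin n → ℕ),
    P {ω | Y ω = y ∧ ∀ b, W b ω = w b}
      = ENNReal.ofReal (poisPMF ν y * ∏ b, binomJointPMF y p (w b))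

lemma hasSum_poisson_mean (r : NNReal) :
    HasSum (fun k : ℕ => Real.exp (-r) * r ^ k / (k.factorial : ℝ) * (k : ℝ)) r := by
  rw [← hasSum_nat_add_iff' 1]
  have h := (hasSum_one_poissonMeasure r).mul_left (r : ℝ)
  simp only [mul_one] at h
  convert! h using 1
  · funext k
    rw [Nat.factorial_succ]
    push_cast
    have : (k : ℝ) + 1 ≠ 0 := by positivity
    field_simp
    ring
  · simp

lemma integrable_natCast_poissonMeasure (r : NNReal) :
    Integrable (fun k : ℕ => (k : ℝ)) (poissonMeasure r) := by
  rw [integrable_poissonMeasure_iff]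
  simpa using (hasSum_poisson_mean r).summable

lemma integral_natCast_poissonMeasure (r : NNReal) :
    ∫ k : ℕ, (k : ℝ) ∂poissonMeasure r = r := by
  rw [integral_poissonMeasure]
  simpa using (hasSum_poisson_mean r).tsum_eq

/-- The law of a vector of independent Poisson variables with means `r i`. -/
def poisVec {n : ℕ} (r : Fin n → NNReal) : Measure (Fin n → ℕ) :=
  Measure.pi fun i => poissonMeasure (r i)

instance {n : ℕ} (r : Fin n → NNReal) : IsProbabilityMeasure (poisVec r) := by
  unfold poisVec; infer_instance

lemma poisPMF_nonneg {n : ℕ} {ν : Fin n → ℝ} (hν : ∀ i, 0 ≤ ν i) (y : Fin n → ℕ) :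
    0 ≤ poisPMF ν y := by
  refine Finset.prod_nonneg fun i _ => ?_
  have := hν i
  positivity

lemma poisVec_singleton {n : ℕ} (r : Fin n → NNReal) (y : Fin n → ℕ) :
    poisVec r {y} = ENNReal.ofReal (poisPMF (fun i => (r i : ℝ)) y) := by
  rw [poisVec, Measure.pi_singleton, poisPMF, ENNReal.ofReal_prod_of_nonneg]
  · simp_rw [poissonMeasure_singleton]
  · intro i _; positivity

lemma poisVec_real_singleton {n : ℕ} (r : Fin n → NNReal) (y : Fin n → ℕ) :
    (poisVec r).real {y} = poisPMF (fun i => (r i : ℝ)) y := by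
  rw [measureReal_def, poisVec_singleton, ENNReal.toReal_ofReal]
  exact poisPMF_nonneg (fun i => (r i).2) y

lemma integrable_eval_poisVec {n : ℕ} (r : Fin n → NNReal) (i : Fin n) :
    Integrable (fun y : Fin n → ℕ => (y i : ℝ)) (poisVec r) :=
  (measurePreserving_eval (fun i => poissonMeasure (r i)) i).integrable_comp_of_integrable
    (integrable_natCast_poissonMeasure (r i))

lemma integral_eval_poisVec {n : ℕ} (r : Fin n → NNReal) (i : Fin n) :
    ∫ y : Fin n → ℕ, (y i : ℝ) ∂poisVec r = r i := by
  rw [poisVec, integral_comp_eval (μ := fun i => poissonMeasure (r i)) (f := fun k : ℕ => (k : ℝ))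
    Measurable.of_discrete.aestronglyMeasurable]
  exact integral_natCast_poissonMeasure (r i)

lemma integrable_of_summable_real_singleton {α : Type*} [Countable α] [MeasurableSpace α]
    [MeasurableSingletonClass α] {μ : Measure α} [IsFiniteMeasure μ] {f : α → ℝ}
    (h : Summable fun a => μ.real {a} * f a) : Integrable f μ := by
  refine ⟨Measurable.of_discrete.aestronglyMeasurable, ?_⟩
  rw [HasFiniteIntegral, lintegral_countable']
  have h2 : ∀ a, ‖f a‖ₑ * μ {a} = ENNReal.ofReal |μ.real {a} * f a| := fun a => by
    rw [abs_mul, abs_of_nonneg measureReal_nonneg, ENNReal.ofReal_mul measureReal_nonneg,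
      ofReal_measureReal, ← Real.norm_eq_abs, ofReal_norm, mul_comm]
  simp_rw [h2]
  exact h.abs.tsum_ofReal_lt_top

/-- The law of a vector of independent binomial variables with sizes `y i`. -/
def binomVec {n : ℕ} (y : Fin n → ℕ) (p : unitInterval) : Measure (Fin n → ℕ) :=
  Measure.pi fun i => binomial (y i) p

instance {n : ℕ} (y : Fin n → ℕ) (p : unitInterval) : IsProbabilityMeasure (binomVec y p) := by
  unfold binomVec; infer_instance

lemma binomJointPMF_nonneg {n : ℕ} (y w : Fin n → ℕ) (p : unitInterval) :
    0 ≤ binomJointPMF y p w :=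
  Finset.prod_nonneg fun _ _ => binomial_nonneg

lemma binomVec_singleton {n : ℕ} (y w : Fin n → ℕ) (p : unitInterval) :
    binomVec y p {w} = ENNReal.ofReal (binomJointPMF y p w) := by
  rw [binomVec, Measure.pi_singleton, binomJointPMF, ENNReal.ofReal_prod_of_nonneg]
  · simp_rw [binomial_singleton, binomPMF]
  · intro i _; exact binomial_nonneg

lemma JointPoisBinomLawMulti.marginal {Ω : Type*} [MeasurableSpace Ω] {n B : ℕ} {P : Measure Ω}
    {ν : Fin n → ℝ} (hν : ∀ i, 0 ≤ ν i) {p : unitInterval} {Y : Ω → Fin n → ℕ}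
    {W : Fin B → Ω → Fin n → ℕ} (hY : Measurable Y) (hW : ∀ b, Measurable (W b))
    (h : JointPoisBinomLawMulti P ν p Y W) (b : Fin B) (y w : Fin n → ℕ) :
    P {ω | Y ω = y ∧ W b ω = w} = ENNReal.ofReal (poisPMF ν y * binomJointPMF y p w) := by
  have hYy : MeasurableSet {ω | Y ω = y} := hY (measurableSet_singleton y)
  have hWm : Measurable fun ω b => W b ω := measurable_pi_lambda _ hW
  have key : (P.restrict {ω | Y ω = y}).map (fun ω b => W b ω)
      = ENNReal.ofReal (poisPMF ν y) • Measure.pi fun _ : Fin B => binomVec y p := by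
    refine Measure.ext_of_singleton fun w' => ?_
    rw [Measure.map_apply hWm (measurableSet_singleton _),
      Measure.restrict_apply (hWm (measurableSet_singleton _)), Measure.smul_apply,
      Measure.pi_singleton, smul_eq_mul]
    simp_rw [binomVec_singleton]
    rw [← ENNReal.ofReal_prod_of_nonneg fun b _ => binomJointPMF_nonneg y (w' b) p,
      ← ENNReal.ofReal_mul (poisPMF_nonneg hν y), ← h y w']
    congr 1
    ext ω
    simp [funext_iff (f := fun b => W b ω), and_comm]
  have h2 := congrArg (fun m => m.map (Function.eval b) {w}) key
  simp only [Measure.map_smul, Measure.smul_apply, smul_eq_mul] at h2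
  rw [(measurePreserving_eval (fun _ : Fin B => binomVec y p) b).map_eq, binomVec_singleton,
    ← ENNReal.ofReal_mul (poisPMF_nonneg hν y), Measure.map_map (measurable_pi_apply b) hWm,
    Measure.map_apply ((measurable_pi_apply b).comp hWm) (measurableSet_singleton _),
    Measure.restrict_apply ((measurable_pi_apply b).comp hWm (measurableSet_singleton _))] at h2
  rw [← h2]
  congr 1
  ext ω
  simp [and_comm]

lemma poisPMF_mul_binomJointPMF {n : ℕ} (ν : Fin n → ℝ) (p : ℝ) (y w : Fin n → ℕ) :
    poisPMF ν (y + w) * binomJointPMF (y + w) p w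
      = poisPMF (fun i => (1 - p) * ν i) y * poisPMF (fun i => p * ν i) w := by
  simp only [poisPMF, binomJointPMF, ← Finset.prod_mul_distrib]
  refine Finset.prod_congr rfl fun i _ => ?_
  simp only [Pi.add_apply, binomPMF, Nat.add_sub_cancel]
  have he : Real.exp (-ν i) = Real.exp (-((1 - p) * ν i)) * Real.exp (-(p * ν i)) := by
    rw [← Real.exp_add]; ring_nf
  have hc : ((y i + w i).choose (w i) : ℝ) * (w i).factorial * (y i).factorial
      = (y i + w i).factorial := by
    have := Nat.choose_mul_factorial_mul_factorial (Nat.le_add_left (w i) (y i))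
    rw [Nat.add_sub_cancel] at this
    exact_mod_cast this
  have h1 : ((y i).factorial : ℝ) ≠ 0 := by positivity
  have h2 : ((w i).factorial : ℝ) ≠ 0 := by positivity
  have h3 : ((y i + w i).factorial : ℝ) ≠ 0 := by positivity
  rw [he, mul_pow, mul_pow, pow_add]
  field_simp
  rw [← hc]
  ring

lemma binomJointPMF_eq_zero {n : ℕ} {y w : Fin n → ℕ} (p : ℝ) (h : ¬ w ≤ y) :
    binomJointPMF y p w = 0 := by
  simp only [Pi.le_def, not_forall, not_le] at h
  obtain ⟨i, hi⟩ := h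
  exact Finset.prod_eq_zero (Finset.mem_univ i) (by simp [binomPMF, Nat.choose_eq_zero_of_lt hi])

/-- Binomial thinning of a Poisson vector: what is removed and what is left are independent
Poisson vectors. -/
lemma JointPoisBinomLawMulti.map_thinning {Ω : Type*} [MeasurableSpace Ω] {n B : ℕ}
    {P : Measure Ω} {ν : Fin n → ℝ} (hν : ∀ i, 0 ≤ ν i) {p : unitInterval} {Y : Ω → Fin n → ℕ}
    {W : Fin B → Ω → Fin n → ℕ} (hY : Measurable Y) (hW : ∀ b, Measurable (W b))
    (h : JointPoisBinomLawMulti P ν p Y W) (b : Fin B) {r s : Fin n → NNReal}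
    (hr : ∀ i, (r i : ℝ) = (1 - p) * ν i) (hs : ∀ i, (s i : ℝ) = p * ν i) :
    P.map (fun ω => (Y ω - W b ω, W b ω)) = (poisVec r).prod (poisVec s) := by
  have hm : Measurable fun ω => (Y ω - W b ω, W b ω) :=
    (Measurable.of_discrete (f := fun q : (Fin n → ℕ) × (Fin n → ℕ) => (q.1 - q.2, q.2))).comp
      (hY.prodMk (hW b))
  have hle : ∀ᵐ ω ∂P, W b ω ≤ Y ω := by
    have : ∀ᵐ q ∂P.map (fun ω => (Y ω, W b ω)), q.2 ≤ q.1 := by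
      rw [ae_iff_of_countable]
      rintro ⟨y, w⟩ hq
      by_contra hlt
      apply hq
      rw [Measure.map_apply (hY.prodMk (hW b)) (measurableSet_singleton _)]
      have := h.marginal hν hY hW b y w
      rw [binomJointPMF_eq_zero _ hlt, mul_zero, ENNReal.ofReal_zero] at this
      rw [← this]
      congr 1
      ext ω
      simp
    exact ae_of_ae_map (hY.prodMk (hW b)).aemeasurable this
  refine Measure.ext_of_singleton ?_
  rintro ⟨y, w⟩
  rw [Measure.map_apply hm (measurableSet_singleton _), ← Set.singleton_prod_singleton,
    Measure.prod_prod, poisVec_singleton, poisVec_singleton]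
  simp_rw [hr, hs]
  rw [← ENNReal.ofReal_mul (poisPMF_nonneg (fun i => by rw [← hr]; positivity) y),
    ← poisPMF_mul_binomJointPMF, ← h.marginal hν hY hW b]
  refine measure_congr ?_
  filter_upwards [hle] with ω hω
  refine propext ?_
  change (Y ω - W b ω, W b ω) ∈ ({y} : Set _) ×ˢ ({w} : Set _) ↔ Y ω = y + w ∧ W b ω = w
  simp only [Set.mem_prod, Set.mem_singleton_iff]
  constructor
  · rintro ⟨rfl, rfl⟩
    exact ⟨(tsub_add_cancel_of_le hω).symm, rfl⟩
  · rintro ⟨h1, rfl⟩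
    exact ⟨by rw [h1, add_tsub_cancel_right], rfl⟩

lemma poisVec_singleton_ne_zero {n : ℕ} (r : Fin n → NNReal) (y : Fin n → ℕ)
    (h : ∀ i, y i ≠ 0 → r i ≠ 0) : poisVec r {y} ≠ 0 := by
  rw [poisVec_singleton, Ne, ENNReal.ofReal_eq_zero, not_le]
  refine Finset.prod_pos fun i _ => ?_
  have : 0 < (r i : ℝ) ^ y i := by
    by_cases hy : y i = 0
    · simp [hy]
    · have := h i hy
      positivity
  positivity

/-- Expectation of `f y - a y - ⟨v y, c • z⟩` for independent `y` and `z`, with `z` Poisson. -/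
lemma integral_affine_poisVec {n : ℕ} {m : Measure (Fin n → ℕ)} [IsProbabilityMeasure m]
    (s : Fin n → NNReal) {f : (Fin n → ℕ) → ℝ}
    {v : (Fin n → ℕ) → Fin n → ℝ} (c : ℝ) (hf : Integrable f m)
    (hv : ∀ i, s i ≠ 0 → Integrable (fun y => v y i) m) :
    Integrable (fun q : (Fin n → ℕ) × (Fin n → ℕ) => f q.1 - ∑ i, v q.1 i * (c * q.2 i))
      (m.prod (poisVec s)) ∧
    ∫ q : (Fin n → ℕ) × (Fin n → ℕ), (f q.1 - ∑ i, v q.1 i * (c * q.2 i)) ∂m.prod (poisVec s)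
      = (∫ y, f y ∂m) - ∑ i, (∫ y, v y i ∂m) * (c * s i) := by
  have hint : ∀ i, Integrable (fun q : (Fin n → ℕ) × (Fin n → ℕ) => v q.1 i * (c * q.2 i))
      (m.prod (poisVec s)) := by
    intro i
    by_cases hi : s i = 0
    · have hz : ∀ᵐ z ∂poisVec s, z i = 0 := by
        rw [ae_iff_of_countable]
        intro z hz
        by_contra h0
        apply hz
        rw [poisVec_singleton, poisPMF, Finset.prod_eq_zero (Finset.mem_univ i) (by simp [hi, h0]),
          ENNReal.ofReal_zero]
      have hz' : ∀ᵐ q : (Fin n → ℕ) × (Fin n → ℕ) ∂m.prod (poisVec s), q.2 i = 0 :=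
        Measure.quasiMeasurePreserving_snd.ae hz
      refine (integrable_zero _ _ _).congr ?_
      filter_upwards [hz'] with q hq
      simp [hq]
    · exact (hv i hi).mul_prod ((integrable_eval_poisVec s i).const_mul c)
  have hf' := hf.comp_fst (poisVec s)
  have hS := integrable_finsetSum Finset.univ fun i _ => hint i
  refine ⟨hf'.sub hS, ?_⟩
  rw [integral_sub hf' hS, integral_finsetSum _ fun i _ => hint i, integral_fun_fst]
  simp only [probReal_univ, one_smul]
  congr 1
  refine Finset.sum_congr rfl fun i _ => ?_
  rw [integral_prod_mul (fun y => v y i) (fun z : Fin n → ℕ => c * (z i : ℝ)),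
    integral_const_mul, integral_eval_poisVec]

/-- Integrability of `f z - a y - ⟨v y, z⟩` for independent Poisson `y`, `z` forces that of each
of its pieces. -/
lemma integrable_pieces_of_integrable {n : ℕ} (r : Fin n → NNReal) {f a : (Fin n → ℕ) → ℝ}
    {v : (Fin n → ℕ) → Fin n → ℝ}
    (h : Integrable (fun q : (Fin n → ℕ) × (Fin n → ℕ) =>
      f q.2 - (a q.1 + ∑ i, v q.1 i * q.2 i)) ((poisVec r).prod (poisVec r))) :
    Integrable f (poisVec r) ∧ Integrable a (poisVec r) ∧
      ∀ i, r i ≠ 0 → Integrable (fun y => v y i) (poisVec r) := by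
  have h0 : poisVec r {0} ≠ 0 := poisVec_singleton_ne_zero r 0 (by simp)
  have hl := fun z hz => ae_iff_of_countable.1 h.prod_left_ae z hz
  have hz := hl 0 h0
  have ha : Integrable a (poisVec r) := by
    refine ((integrable_const (f 0)).sub hz).congr (ae_of_all _ fun y => ?_)
    simp
  refine ⟨?_, ha, fun i hi => ?_⟩
  · have h1 : Integrable (fun z => f z - (a 0 + ∑ i, v 0 i * (z i : ℝ))) (poisVec r) :=
      ae_iff_of_countable.1 h.prod_right_ae 0 h0
    have h2 : Integrable (fun z : Fin n → ℕ => a 0 + ∑ i, v 0 i * (z i : ℝ)) (poisVec r) :=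
      (integrable_const _).add
        (integrable_finsetSum _ fun i _ => (integrable_eval_poisVec r i).const_mul _)
    refine (h1.add h2).congr (ae_of_all _ fun z => ?_)
    simp
  · have h1 := hl (Pi.single i 1) (poisVec_singleton_ne_zero r _ fun j hj => by
      rcases eq_or_ne j i with rfl | hne
      · exact hi
      · simp [hne] at hj)
    refine (((integrable_const (f (Pi.single i 1))).sub ha).sub h1).congr
      (ae_of_all _ fun y => ?_)
    simp [Pi.single_apply]

/-- the coupled bootstrap estimator `CB_p(g)` is unbiased for the
mean-shrunken test error `Err_p(g) = E[D_φ(Ỹ_p, g(Y_p))]`, `Y_p, Ỹ_p ~ Pois((1-p)μ)`. -/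
theorem stmt10 {n B : ℕ} {Ω : Type*} [MeasurableSpace Ω] (P : Measure Ω)
    [IsProbabilityMeasure P]
    (μ : Fin n → ℝ) (hμ : ∀ i, 0 ≤ μ i) (p : ℝ) (hp0 : 0 < p) (hp1 : p < 1) (hB : 1 ≤ B)
    (Y : Ω → Fin n → ℕ) (W : Fin B → Ω → Fin n → ℕ)
    (hYm : Measurable Y) (hWm : ∀ b, Measurable (W b))
    (hlaw : JointPoisBinomLawMulti P μ p Y W)
    (g : (Fin n → ℕ) → Fin n → ℝ)
    (φ : (Fin n → ℝ) → ℝ) (φ' : (Fin n → ℝ) → Fin n → ℝ)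
    (hconv : ConvexOn ℝ Set.univ φ) (hgrad : HasGrad φ φ')
    (hint : Integrable (fun ω => (B : ℝ)⁻¹ * ∑ b,
      (breg φ φ' (fun i => (1 - p) / p * (W b ω i : ℝ)) (g (Y ω - W b ω))
        + φ (toR (Y ω - W b ω)) - φ (fun i => (1 - p) / p * (W b ω i : ℝ)))) P)
    (hsum : Summable (fun yz : (Fin n → ℕ) × (Fin n → ℕ) =>
      poisPMF (fun i => (1 - p) * μ i) yz.1 * poisPMF (fun i => (1 - p) * μ i) yz.2 *
        breg φ φ' (toR yz.2) (g yz.1))) :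
    (∫ ω, (B : ℝ)⁻¹ * ∑ b,
        (breg φ φ' (fun i => (1 - p) / p * (W b ω i : ℝ)) (g (Y ω - W b ω))
          + φ (toR (Y ω - W b ω)) - φ (fun i => (1 - p) / p * (W b ω i : ℝ))) ∂P)
      = ∑' yz : (Fin n → ℕ) × (Fin n → ℕ),
          poisPMF (fun i => (1 - p) * μ i) yz.1 * poisPMF (fun i => (1 - p) * μ i) yz.2 *
            breg φ φ' (toR yz.2) (g yz.1) := by
  have hB0 : (B : ℝ) ≠ 0 := by positivity
  let r : Fin n → NNReal := fun i => ⟨(1 - p) * μ i, mul_nonneg (by linarith) (hμ i)⟩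
  let s : Fin n → NNReal := fun i => ⟨p * μ i, mul_nonneg hp0.le (hμ i)⟩
  have hrs : ∀ i, s i ≠ 0 → r i ≠ 0 := fun i hi hr => by
    have h1 : (1 - p) * μ i = 0 := congrArg NNReal.toReal hr
    refine hi (NNReal.coe_injective (?_ : p * μ i = 0))
    rw [(mul_eq_zero.1 h1).resolve_left (by linarith), mul_zero]
  let f : (Fin n → ℕ) → ℝ := fun z => φ (toR z)
  let v : (Fin n → ℕ) → Fin n → ℝ := fun y => φ' (g y)
  let a : (Fin n → ℕ) → ℝ := fun y => φ (g y) - ∑ i, v y i * g y i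
  have hbreg : ∀ (x : Fin n → ℝ) y,
      breg φ φ' x (g y) = φ x - (a y + ∑ i, v y i * x i) := fun x y => by
    simp only [breg, dotR, a, v, mul_sub, Finset.sum_sub_distrib]
    ring
  have hreal : ∀ q : (Fin n → ℕ) × (Fin n → ℕ), ((poisVec r).prod (poisVec r)).real {q}
      = poisPMF (fun i => (1 - p) * μ i) q.1 * poisPMF (fun i => (1 - p) * μ i) q.2 := by
    rintro ⟨y, z⟩
    rw [← Set.singleton_prod_singleton, measureReal_prod_prod, poisVec_real_singleton,
      poisVec_real_singleton]
    rfl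
  have hF : Integrable (fun q : (Fin n → ℕ) × (Fin n → ℕ) =>
      f q.2 - (a q.1 + ∑ i, v q.1 i * q.2 i)) ((poisVec r).prod (poisVec r)) := by
    refine integrable_of_summable_real_singleton (hsum.congr fun q => ?_)
    rw [hreal, hbreg]
    rfl
  obtain ⟨hf, ha, hv⟩ := integrable_pieces_of_integrable r hF
  have hR := integral_affine_poisVec (m := poisVec r) (f := fun y => - a y) (v := v) r 1 ha.neg hv
  have hL := integral_affine_poisVec (m := poisVec r) (f := fun y => f y - a y) (v := v) s
    ((1 - p) / p) (hf.sub ha) fun i hi => hv i (hrs i hi)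
  have hright : ∑' yz : (Fin n → ℕ) × (Fin n → ℕ),
      poisPMF (fun i => (1 - p) * μ i) yz.1 * poisPMF (fun i => (1 - p) * μ i) yz.2 *
        breg φ φ' (toR yz.2) (g yz.1)
      = (∫ y, f y ∂poisVec r) - (∫ y, a y ∂poisVec r)
        - ∑ i, (∫ y, v y i ∂poisVec r) * ((1 - p) * μ i) := by
    calc _ = ∫ q : (Fin n → ℕ) × (Fin n → ℕ), (f q.2 - (a q.1 + ∑ i, v q.1 i * q.2 i))
          ∂(poisVec r).prod (poisVec r) := by
          rw [integral_countable hF]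
          refine tsum_congr fun q => ?_
          rw [hreal, hbreg]
          rfl
      _ = ∫ q : (Fin n → ℕ) × (Fin n → ℕ), (f q.2 + (- a q.1 - ∑ i, v q.1 i * (1 * q.2 i)))
          ∂(poisVec r).prod (poisVec r) := by
          refine integral_congr_ae (ae_of_all _ fun q => ?_)
          simp only [one_mul]
          ring
      _ = _ := by
          rw [integral_add (hf.comp_snd (poisVec r)) hR.1, hR.2, integral_fun_snd, integral_neg]
          simp only [probReal_univ, one_smul, one_mul]
          rw [add_sub_assoc', ← sub_eq_add_neg]
          rfl
  obtain ⟨T, hT⟩ : ∃ T : (Fin n → ℕ) × (Fin n → ℕ) → ℝ,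
      T = fun q => (f q.1 - a q.1) - ∑ i, v q.1 i * ((1 - p) / p * q.2 i) := ⟨_, rfl⟩
  rw [← hT] at hL
  have hterm : ∀ (b : Fin B) ω, breg φ φ' (fun i => (1 - p) / p * (W b ω i : ℝ)) (g (Y ω - W b ω))
      + φ (toR (Y ω - W b ω)) - φ (fun i => (1 - p) / p * (W b ω i : ℝ))
      = T (Y ω - W b ω, W b ω) := fun b ω => by
    rw [hbreg, hT]
    simp only [f]
    ring
  have hm : ∀ b, Measurable fun ω => (Y ω - W b ω, W b ω) := fun b =>
    (Measurable.of_discrete (f := fun q : (Fin n → ℕ) × (Fin n → ℕ) => (q.1 - q.2, q.2))).comp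
      (hYm.prodMk (hWm b))
  have hthin : ∀ b, P.map (fun ω => (Y ω - W b ω, W b ω)) = (poisVec r).prod (poisVec s) :=
    fun b => JointPoisBinomLawMulti.map_thinning (p := ⟨p, hp0.le, hp1.le⟩) hμ hYm hWm hlaw b
      (fun _ => rfl) (fun _ => rfl)
  have hL1 := fun b => hthin b ▸ hL.1
  have hL2 : ∀ b, Integrable (fun ω => T (Y ω - W b ω, W b ω)) P :=
    fun b => (hL1 b).comp_measurable (hm b)
  simp_rw [hterm]
  rw [integral_const_mul, integral_finsetSum _ fun b _ => hL2 b]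
  have hb : ∀ b, ∫ ω, T (Y ω - W b ω, W b ω) ∂P
      = (∫ y, f y ∂poisVec r) - (∫ y, a y ∂poisVec r)
        - ∑ i, (∫ y, v y i ∂poisVec r) * ((1 - p) * μ i) := fun b => by
    rw [← integral_map (hm b).aemeasurable (hL1 b).aestronglyMeasurable, hthin b, hL.2,
      integral_sub hf ha]
    congr 1
    refine Finset.sum_congr rfl fun i _ => ?_
    change _ * ((1 - p) / p * (p * μ i)) = _
    rw [← mul_assoc ((1 - p) / p), div_mul_cancel₀ _ hp0.ne']
  rw [Finset.sum_congr rfl fun b _ => hb b, hright]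
  rw [Finset.sum_const, Finset.card_univ, Fintype.card_fin, nsmul_eq_mul, inv_mul_cancel_left₀ hB0]
end
end
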